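/- Let t ∈ ℂ and s₀ = t²/2 − 2. Suppose x₁, x₂, x₃ ∈ G(t) satisfy s₁₂₃ := tr(x̌₁x̌₂x̌₃) ≠ 0, and write s_{ij} = tr(x̌ᵢx̌ⱼ) for 1 ≤ i, j ≤ 3. Suppose given complex numbers s₁₄, s₂₄, s₃₄, s₄₄ and s₁₂₄, s₁₃₄, s₂₃₄ such that s₄₄ = s₀ and s_{i1}·s₂₃₄ − s_{i2}·s₁₃₄ + s_{i3}·s₁₂₄ − s_{i4}·s₁₂₃ = 0 for each i = 1, 2, 3, 4 (where s_{4j} = s_{j4}). Then there exists a unique x₄ ∈ G(t) such that tr(x̌ᵢx̌₄) = s_{i4} for i = 1,2,3 and tr(x̌₁x̌₂x̌₄) = s₁₂₄, tr(x̌₁x̌₃x̌₄) = s₁₃₄, tr(x̌₂x̌₃x̌₄) = s₂₃₄; and this x₄ satisfies x̌₄ = (s₂₃₄/s₁₂₃)·x̌₁ − (s₁₃₄/s₁₂₃)·x̌₂ + (s₁₂₄/s₁₂₃)·x̌₃. -/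

import Mathlib

open Matrix

local notation "𝕄" => Matrix (Fin 2) (Fin 2) ℂ
local notation "SL2" => Matrix.SpecialLinearGroup (Fin 2) ℂ

/-- `x̌ = x − (tr x / 2)·I`, the trace-free part of a 2×2 matrix. -/
noncomputable def chk (x : Matrix (Fin 2) (Fin 2) ℂ) : Matrix (Fin 2) (Fin 2) ℂ :=
  x - (x.trace / 2) • 1

theorem chk_trace (x : Matrix (Fin 2) (Fin 2) ℂ) : (chk x).trace = 0 := by
  simp [chk, Matrix.trace_fin_two]

theorem tl_form (A : Matrix (Fin 2) (Fin 2) ℂ) (h : A.trace = 0) :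
    ∃ a b c : ℂ, A = !![a, b; c, -a] := by
  refine ⟨A 0 0, A 0 1, A 1 0, ?_⟩
  have h' : A 1 1 = - A 0 0 := by
    rw [Matrix.trace_fin_two] at h
    linear_combination h
  rw [← h']
  exact Matrix.eta_fin_two A

/-- Four-vector identity for trace-free matrices. -/
theorem tl_four (A B C Z : Matrix (Fin 2) (Fin 2) ℂ) (hA : A.trace = 0) (hB : B.trace = 0)
    (hC : C.trace = 0) (hZ : Z.trace = 0) :
    (A * B * C).trace • Z = (B * C * Z).trace • A - (A * C * Z).trace • B
      + (A * B * Z).trace • C := by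
  obtain ⟨a, b, c, rfl⟩ := tl_form A hA
  obtain ⟨d, e, f, rfl⟩ := tl_form B hB
  obtain ⟨g, h, i, rfl⟩ := tl_form C hC
  obtain ⟨j, k, l, rfl⟩ := tl_form Z hZ
  ext p q
  fin_cases p <;> fin_cases q <;> simp [Matrix.trace_fin_two] <;> ring

theorem tl_aba (A B C : Matrix (Fin 2) (Fin 2) ℂ) (hA : A.trace = 0) (hB : B.trace = 0)
    (hC : C.trace = 0) :
    (A * B * A).trace = 0 ∧ (A * B * B).trace = 0 ∧
    (A * C * B).trace = - (A * B * C).trace ∧ (B * C * A).trace = (A * B * C).trace := by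
  obtain ⟨a, b, c, rfl⟩ := tl_form A hA
  obtain ⟨d, e, f, rfl⟩ := tl_form B hB
  obtain ⟨g, h, i, rfl⟩ := tl_form C hC
  refine ⟨?_, ?_, ?_, ?_⟩ <;> simp [Matrix.trace_fin_two] <;> ring

theorem tl_det (A : Matrix (Fin 2) (Fin 2) ℂ) (hA : A.trace = 0) (r : ℂ) :
    (A + r • (1 : Matrix (Fin 2) (Fin 2) ℂ)).det = r ^ 2 - (A * A).trace / 2 ∧
    (A + r • (1 : Matrix (Fin 2) (Fin 2) ℂ)).trace = 2 * r ∧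
    chk (A + r • (1 : Matrix (Fin 2) (Fin 2) ℂ)) = A := by
  obtain ⟨a, b, c, rfl⟩ := tl_form A hA
  refine ⟨?_, ?_, ?_⟩
  · simp [Matrix.trace_fin_two, Matrix.det_fin_two]
    ring
  · simp [Matrix.trace_fin_two]
    ring
  · ext p q
    fin_cases p <;> fin_cases q <;> simp [chk, Matrix.trace_fin_two] <;> ring

theorem chk_add (x : Matrix (Fin 2) (Fin 2) ℂ) : x = chk x + (x.trace / 2) • 1 := by
  simp [chk]

/-- Given `x₁,x₂,x₃ ∈ G(t)` with `s₁₂₃ = tr(x̌₁x̌₂x̌₃) ≠ 0` and data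
`s₁₄, s₂₄, s₃₄, s₄₄, s₁₂₄, s₁₃₄, s₂₃₄` with `s₄₄ = t²/2 − 2` satisfying the type II
relations, there is a unique `x₄ ∈ G(t)` realizing these traces; moreover
`x̌₄ = (s₂₃₄/s₁₂₃)x̌₁ − (s₁₃₄/s₁₂₃)x̌₂ + (s₁₂₄/s₁₂₃)x̌₃`. -/
theorem exists_unique_fourth_matrix (t : ℂ) (x₁ x₂ x₃ : SL2)
    (hx₁ : ((x₁ : 𝕄)).trace = t) (hx₂ : ((x₂ : 𝕄)).trace = t) (hx₃ : ((x₃ : 𝕄)).trace = t)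
    (s₁₂₃ s₁₄ s₂₄ s₃₄ s₄₄ s₁₂₄ s₁₃₄ s₂₃₄ : ℂ)
    (hs₁₂₃ : s₁₂₃ = (chk (x₁ : 𝕄) * chk (x₂ : 𝕄) * chk (x₃ : 𝕄)).trace)
    (hne : s₁₂₃ ≠ 0)
    (hs₄₄ : s₄₄ = t ^ 2 / 2 - 2)
    (hrel₁ : (chk (x₁ : 𝕄) * chk (x₁ : 𝕄)).trace * s₂₃₄
        - (chk (x₁ : 𝕄) * chk (x₂ : 𝕄)).trace * s₁₃₄
        + (chk (x₁ : 𝕄) * chk (x₃ : 𝕄)).trace * s₁₂₄ - s₁₄ * s₁₂₃ = 0)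
    (hrel₂ : (chk (x₂ : 𝕄) * chk (x₁ : 𝕄)).trace * s₂₃₄
        - (chk (x₂ : 𝕄) * chk (x₂ : 𝕄)).trace * s₁₃₄
        + (chk (x₂ : 𝕄) * chk (x₃ : 𝕄)).trace * s₁₂₄ - s₂₄ * s₁₂₃ = 0)
    (hrel₃ : (chk (x₃ : 𝕄) * chk (x₁ : 𝕄)).trace * s₂₃₄
        - (chk (x₃ : 𝕄) * chk (x₂ : 𝕄)).trace * s₁₃₄
        + (chk (x₃ : 𝕄) * chk (x₃ : 𝕄)).trace * s₁₂₄ - s₃₄ * s₁₂₃ = 0)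
    (hrel₄ : s₁₄ * s₂₃₄ - s₂₄ * s₁₃₄ + s₃₄ * s₁₂₄ - s₄₄ * s₁₂₃ = 0) :
    ∃ x₄ : SL2,
      (((x₄ : 𝕄)).trace = t ∧
        (chk (x₁ : 𝕄) * chk (x₄ : 𝕄)).trace = s₁₄ ∧
        (chk (x₂ : 𝕄) * chk (x₄ : 𝕄)).trace = s₂₄ ∧
        (chk (x₃ : 𝕄) * chk (x₄ : 𝕄)).trace = s₃₄ ∧
        (chk (x₁ : 𝕄) * chk (x₂ : 𝕄) * chk (x₄ : 𝕄)).trace = s₁₂₄ ∧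
        (chk (x₁ : 𝕄) * chk (x₃ : 𝕄) * chk (x₄ : 𝕄)).trace = s₁₃₄ ∧
        (chk (x₂ : 𝕄) * chk (x₃ : 𝕄) * chk (x₄ : 𝕄)).trace = s₂₃₄ ∧
        chk (x₄ : 𝕄) = (s₂₃₄ / s₁₂₃) • chk (x₁ : 𝕄) - (s₁₃₄ / s₁₂₃) • chk (x₂ : 𝕄)
          + (s₁₂₄ / s₁₂₃) • chk (x₃ : 𝕄)) ∧
      ∀ y₄ : SL2,
        ((y₄ : 𝕄)).trace = t →
        (chk (x₁ : 𝕄) * chk (y₄ : 𝕄)).trace = s₁₄ →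
        (chk (x₂ : 𝕄) * chk (y₄ : 𝕄)).trace = s₂₄ →
        (chk (x₃ : 𝕄) * chk (y₄ : 𝕄)).trace = s₃₄ →
        (chk (x₁ : 𝕄) * chk (x₂ : 𝕄) * chk (y₄ : 𝕄)).trace = s₁₂₄ →
        (chk (x₁ : 𝕄) * chk (x₃ : 𝕄) * chk (y₄ : 𝕄)).trace = s₁₃₄ →
        (chk (x₂ : 𝕄) * chk (x₃ : 𝕄) * chk (y₄ : 𝕄)).trace = s₂₃₄ →
        y₄ = x₄ := by
  have tA := chk_trace (x₁ : 𝕄)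
  have tB := chk_trace (x₂ : 𝕄)
  have tC := chk_trace (x₃ : 𝕄)
  set A := chk (x₁ : 𝕄) with hA
  set B := chk (x₂ : 𝕄) with hB
  set C := chk (x₃ : 𝕄) with hC
  obtain ⟨Y, hY⟩ : ∃ Y : 𝕄, Y = (s₂₃₄ / s₁₂₃) • A - (s₁₃₄ / s₁₂₃) • B + (s₁₂₄ / s₁₂₃) • C :=
    ⟨_, rfl⟩
  have tY : Y.trace = 0 := by simp [hY, tA, tB, tC]
  have lin : ∀ M : 𝕄, (M * Y).trace = (s₂₃₄ / s₁₂₃) * (M * A).trace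
      - (s₁₃₄ / s₁₂₃) * (M * B).trace + (s₁₂₄ / s₁₂₃) * (M * C).trace := by
    intro M
    simp [hY, Matrix.mul_add, Matrix.mul_sub]
  have e1 : (A * Y).trace = s₁₄ := by
    rw [lin]
    field_simp
    linear_combination hrel₁
  have e2 : (B * Y).trace = s₂₄ := by
    rw [lin]
    field_simp
    linear_combination hrel₂
  have e3 : (C * Y).trace = s₃₄ := by
    rw [lin]
    field_simp
    linear_combination hrel₃
  have e4 : (Y * Y).trace = s₄₄ := by
    rw [lin, Matrix.trace_mul_comm Y A, Matrix.trace_mul_comm Y B, Matrix.trace_mul_comm Y C,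
      e1, e2, e3]
    field_simp
    linear_combination hrel₄
  obtain ⟨q1, q2, q3, q4⟩ := tl_aba A B C tA tB tC
  obtain ⟨r1, r2, -, -⟩ := tl_aba A C B tA tC tB
  obtain ⟨u1, u2, -, -⟩ := tl_aba B C A tB tC tA
  have e5 : (A * B * Y).trace = s₁₂₄ := by
    rw [lin, q1, q2, ← hs₁₂₃]
    field_simp
    ring
  have e6 : (A * C * Y).trace = s₁₃₄ := by
    rw [lin, r1, r2, q3, ← hs₁₂₃]
    field_simp
    ring
  have e7 : (B * C * Y).trace = s₂₃₄ := by
    rw [lin, u1, u2, q4, ← hs₁₂₃]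
    field_simp
    ring
  obtain ⟨d1, d2, d3⟩ := tl_det Y tY (t / 2)
  have hdet : (Y + (t / 2) • (1 : 𝕄)).det = 1 := by
    rw [d1, e4, hs₄₄]
    ring
  refine ⟨⟨Y + (t / 2) • (1 : 𝕄), hdet⟩, ?_, ?_⟩
  · simp only [d3]
    exact ⟨by rw [d2]; ring, e1, e2, e3, e5, e6, e7, hY⟩
  · intro y hy _ _ _ h5 h6 h7
    have tZ := chk_trace (y : 𝕄)
    have k1 := tl_four A B C (chk (y : 𝕄)) tA tB tC tZ
    have k2 := tl_four A B C Y tA tB tC tY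
    rw [h5, h6, h7, ← hs₁₂₃] at k1
    rw [e5, e6, e7, ← hs₁₂₃, ← k1] at k2
    have k3 : Y = chk (y : 𝕄) := smul_right_injective _ hne k2
    apply Subtype.ext
    change (y : 𝕄) = Y + (t / 2) • (1 : 𝕄)
    rw [k3, ← hy]
    exact chk_add _
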